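/- Let a, b, c ∈ (0,1) with b between a and c, i.e. either a ≤ b ≤ c or c ≤ b ≤ a. Then kl(a,b) + kl(b,c) ≤ kl(a,c), where kl(s,t) = s·log(s/t) + (1−s)·log((1−s)/(1−t)). -/

import Mathlib

/-- Kullback–Leibler divergence between Bernoulli distributions with success
probabilities `s` and `t`. -/
noncomputable def klBer (s t : ℝ) : ℝ :=
  s * Real.log (s / t) + (1 - s) * Real.log ((1 - s) / (1 - t))

/-- Two-step case of Theorem A.4: for `a, b, c ∈ (0,1)` with `b` between `a` and `c`,
the bridged Bernoulli KL loss through `b` is at most the direct KL divergence. -/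
theorem klBer_bridge_le
    (a b c : ℝ) (ha : a ∈ Set.Ioo (0 : ℝ) 1) (hb : b ∈ Set.Ioo (0 : ℝ) 1)
    (hc : c ∈ Set.Ioo (0 : ℝ) 1)
    (hbetween : (a ≤ b ∧ b ≤ c) ∨ (c ≤ b ∧ b ≤ a)) :
    klBer a b + klBer b c ≤ klBer a c := by
  obtain ⟨ha0, ha1⟩ := ha
  obtain ⟨hb0, hb1⟩ := hb
  obtain ⟨hc0, hc1⟩ := hc
  have ha1' : 0 < 1 - a := by linarith
  have hb1' : 0 < 1 - b := by linarith
  have hc1' : 0 < 1 - c := by linarith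
  unfold klBer
  rw [Real.log_div ha0.ne' hb0.ne', Real.log_div ha1'.ne' hb1'.ne',
    Real.log_div hb0.ne' hc0.ne', Real.log_div hb1'.ne' hc1'.ne',
    Real.log_div ha0.ne' hc0.ne', Real.log_div ha1'.ne' hc1'.ne']
  rcases hbetween with ⟨h1, h2⟩ | ⟨h1, h2⟩
  · have l1 := Real.log_le_log hb0 h2
    have l2 : Real.log (1 - c) ≤ Real.log (1 - b) := Real.log_le_log hc1' (by linarith)
    nlinarith [mul_nonneg (sub_nonneg.2 h1) (sub_nonneg.2 l1),
      mul_nonneg (sub_nonneg.2 h1) (sub_nonneg.2 l2)]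
  · have l1 := Real.log_le_log hc0 h1
    have l2 : Real.log (1 - b) ≤ Real.log (1 - c) := Real.log_le_log hb1' (by linarith)
    nlinarith [mul_nonneg (sub_nonneg.2 h2) (sub_nonneg.2 l1),
      mul_nonneg (sub_nonneg.2 h2) (sub_nonneg.2 l2)]
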